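/- arXiv:1911.04758 — 5 statements merged into one kernel-verified Lean document; each statement's English description precedes it below -/
import Mathlib

section
/- Let H be a real Hilbert space, A : H → Set H maximally monotone, B : H → H monotone and (1/β)-Lipschitz continuous with β > 0, and for each γ > 0 let J_γ : H → H be a resolvent of γA. For ε ≥ 0 and γ > 0 define R_{ε,γ} : H → H by R_{ε,γ}(x) := γ·[ B( J_γ( x − γ·B x ) ) − B( J_γ( x − γ·(B x + ε·x) ) ) ] + γ·ε·[ x − J_γ( x − γ·(B x + ε·x) ) ]. Then for every x ∈ H with A x ≠ ∅ (i.e. x ∈ dom A), R_{ε,γ}(x) → 0 as (ε, γ) → (0, 0) with ε > 0, γ > 0. -/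
open Filter MeasureTheory Set Topology
open scoped RealInnerProductSpace

variable {H : Type*} [NormedAddCommGroup H] [InnerProductSpace ℝ H] [CompleteSpace H]

/-- A set-valued operator is monotone. -/
def MonotoneSV (A : H → Set H) : Prop :=
  ∀ x y u v : H, u ∈ A x → v ∈ A y → 0 ≤ ⟪u - v, x - y⟫

/-- A set-valued operator is maximally monotone. -/
def MaximallyMonotone (A : H → Set H) : Prop :=
  MonotoneSV A ∧ ∀ x u : H, (∀ y v : H, v ∈ A y → 0 ≤ ⟪u - v, x - y⟫) → u ∈ A x

/-- The residual vector field `R_{ε,γ}`. -/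
def Reg (B : H → H) (J : ℝ → H → H) (ε γ : ℝ) (x : H) : H :=
  γ • (B (J γ (x - γ • B x)) - B (J γ (x - γ • (B x + ε • x)))) +
    (γ * ε) • (x - J γ (x - γ • (B x + ε • x)))

/-- The resolvent moves a point of the domain by at most `O(γ)`. -/
theorem resolvent_bound (A : H → Set H) (hA : MonotoneSV A) (J : ℝ → H → H)
    (hJ : ∀ γ : ℝ, 0 < γ → ∀ w : H, (1 / γ) • (w - J γ w) ∈ A (J γ w))
    (x u b : H) (hu : u ∈ A x) (γ : ℝ) (hγ : 0 < γ) :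
    ‖x - J γ (x - γ • b)‖ ≤ γ * ‖b + u‖ := by
  have h := hA _ _ _ _ (hJ γ hγ (x - γ • b)) hu
  set p := J γ (x - γ • b) with hp
  have e : (1 / γ) • (x - γ • b - p) - u = (1 / γ) • (x - p) - (b + u) := by
    have : (1 / γ) • (γ • b) = b := by
      rw [smul_smul, one_div, inv_mul_cancel₀ hγ.ne', one_smul]
    rw [show x - γ • b - p = (x - p) - γ • b by abel, smul_sub, this]
    abel
  rw [e, ← neg_sub x p, inner_neg_right, inner_sub_left, real_inner_smul_left,
    real_inner_self_eq_norm_sq] at h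
  have h2 := real_inner_le_norm (b + u) (x - p)
  have h3 : (1 / γ) * ‖x - p‖ ^ 2 ≤ ‖b + u‖ * ‖x - p‖ := by linarith
  have h4 : ‖x - p‖ ^ 2 ≤ γ * (‖b + u‖ * ‖x - p‖) := by
    rw [one_div, inv_mul_le_iff₀ hγ] at h3
    exact h3
  rcases (norm_nonneg (x - p)).eq_or_lt with h0 | h0
  · rw [← h0]; positivity
  · refine le_of_mul_le_mul_right ?_ h0
    nlinarith

theorem stmt14 (A : H → Set H) (B : H → H) (β : ℝ) (hβ : 0 < β)
    (hA : MaximallyMonotone A)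
    (hBmono : ∀ x y : H, 0 ≤ ⟪B x - B y, x - y⟫)
    (hBlip : ∀ x y : H, ‖B x - B y‖ ≤ (1 / β) * ‖x - y‖)
    (J : ℝ → H → H)
    (hJ : ∀ γ : ℝ, 0 < γ → ∀ w : H, (1 / γ) • (w - J γ w) ∈ A (J γ w))
    (x : H) (hx : (A x).Nonempty) :
    Tendsto (fun p : ℝ × ℝ => Reg B J p.1 p.2 x)
      (𝓝[Set.Ioi (0:ℝ) ×ˢ Set.Ioi (0:ℝ)] ((0:ℝ), (0:ℝ))) (𝓝 (0 : H)) := by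
  obtain ⟨u, hu⟩ := hx
  have key := resolvent_bound A hA.1 J hJ x u
  let g : ℝ × ℝ → ℝ := fun p =>
    p.2 * ((1 / β) * (p.2 * ‖B x + u‖ + p.2 * ‖B x + p.1 • x + u‖)) +
      (p.2 * p.1) * (p.2 * ‖B x + p.1 • x + u‖)
  have hg : Continuous g := by fun_prop
  have hg0 : Tendsto g (𝓝[Set.Ioi (0:ℝ) ×ˢ Set.Ioi (0:ℝ)] ((0:ℝ), (0:ℝ))) (𝓝 0) := by
    have h := hg.tendsto ((0:ℝ), (0:ℝ))
    have e : g ((0:ℝ), (0:ℝ)) = 0 := by simp [g]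
    rw [e] at h
    exact h.mono_left nhdsWithin_le_nhds
  refine squeeze_zero_norm' ?_ hg0
  filter_upwards [self_mem_nhdsWithin] with p hp
  obtain ⟨h1, h2⟩ := hp
  obtain ⟨ε, γ⟩ := p
  simp only [Set.mem_Ioi] at h1 h2
  have k1 := key (B x) hu γ h2
  have k2 := key (B x + ε • x) hu γ h2
  simp only [Reg, g]
  refine (norm_add_le _ _).trans (add_le_add ?_ ?_)
  · rw [norm_smul, Real.norm_of_nonneg h2.le]
    refine mul_le_mul_of_nonneg_left ((hBlip _ _).trans ?_) h2.le
    refine mul_le_mul_of_nonneg_left ?_ (by positivity)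
    refine (norm_sub_le_norm_sub_add_norm_sub _ x _).trans (add_le_add ?_ k2)
    rw [norm_sub_rev]; exact k1
  · rw [norm_smul, Real.norm_of_nonneg (by positivity)]
    exact mul_le_mul_of_nonneg_left k2 (by positivity)
end

section
/- Let H be a real Hilbert space, A : H → Set H maximally monotone, B : H → H monotone and (1/β)-Lipschitz continuous with β > 0, and for each γ > 0 let J_γ : H → H be a resolvent of γA. For ε ≥ 0 and γ > 0 set B_ε := B + ε·Id, C_{ε,γ} := Id − γ·B_ε, and define V_{ε,γ} : H → H by V_{ε,γ}(x) := C_{ε,γ}( J_γ( C_{ε,γ} x ) ) − C_{ε,γ} x. Then for every x ∈ H with A x ≠ ∅ (i.e. x ∈ dom A), V_{ε,γ}(x) → 0 as (ε, γ) → (0, 0) with ε > 0, γ > 0. -/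
open Filter MeasureTheory Set Topology
open scoped RealInnerProductSpace

variable {H : Type*} [NormedAddCommGroup H] [InnerProductSpace ℝ H] [CompleteSpace H]

/-- The forward-backward-forward vector field `V_{ε,γ}(x) = C_{ε,γ}(J(C_{ε,γ} x)) − C_{ε,γ} x`,
where `C_{ε,γ} = Id − γ·(B + ε·Id)`. -/
def Veg (B J : H → H) (ε γ : ℝ) (x : H) : H :=
  (fun w => w - γ • (B w + ε • w)) (J ((fun w => w - γ • (B w + ε • w)) x)) -
    (fun w => w - γ • (B w + ε • w)) x

theorem stmt15 (A : H → Set H) (B : H → H) (β : ℝ) (hβ : 0 < β)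
    (hA : MaximallyMonotone A)
    (hBmono : ∀ x y : H, 0 ≤ ⟪B x - B y, x - y⟫)
    (hBlip : ∀ x y : H, ‖B x - B y‖ ≤ (1 / β) * ‖x - y‖)
    (J : ℝ → H → H)
    (hJ : ∀ γ : ℝ, 0 < γ → ∀ w : H, (1 / γ) • (w - J γ w) ∈ A (J γ w))
    (x : H) (hx : (A x).Nonempty) :
    Tendsto (fun p : ℝ × ℝ => Veg B (J p.2) p.1 p.2 x)
      (𝓝[Set.Ioi (0:ℝ) ×ˢ Set.Ioi (0:ℝ)] ((0:ℝ), (0:ℝ))) (𝓝 (0 : H)) := by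
  obtain ⟨u, hu⟩ := hx
  have key : ∀ p ∈ Set.Ioi (0:ℝ) ×ˢ Set.Ioi (0:ℝ), ‖Veg B (J p.2) p.1 p.2 x‖ ≤
      (1 + p.2 * (1 / β + p.1)) * (p.2 * ‖B x + p.1 • x + u‖) := by
    rintro ⟨ε, γ⟩ ⟨hε, hγ⟩
    simp only [Set.mem_Ioi] at hε hγ
    simp only [Veg]
    have hm := hA.1 _ _ _ _ (hJ γ hγ (x - γ • (B x + ε • x))) hu
    generalize J γ (x - γ • (B x + ε • x)) = z at *
    have e1 : (1 / γ) • (x - γ • (B x + ε • x) - z) - u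
        = -((1 / γ) • (z - x)) - (B x + ε • x + u) := by
      have : (1 / γ) • (γ • (B x + ε • x)) = B x + ε • x := by
        rw [smul_smul, one_div, inv_mul_cancel₀ hγ.ne', one_smul]
      rw [smul_sub, smul_sub, this, smul_sub]
      abel
    rw [e1, inner_sub_left, inner_neg_left, real_inner_smul_left,
      real_inner_self_eq_norm_sq] at hm
    have hcs := neg_le_of_abs_le (abs_real_inner_le_norm (B x + ε • x + u) (z - x))
    have hz : ‖z - x‖ ≤ γ * ‖B x + ε • x + u‖ := by
      have h1 : (1 / γ) * ‖z - x‖ ^ 2 ≤ ‖B x + ε • x + u‖ * ‖z - x‖ := by linarith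
      rw [one_div, inv_mul_le_iff₀ hγ] at h1
      rcases (norm_nonneg (z - x)).eq_or_lt with h0 | h0
      · rw [← h0]; positivity
      · refine le_of_mul_le_mul_right ?_ h0
        nlinarith
    have e2 : z - γ • (B z + ε • z) - (x - γ • (B x + ε • x))
        = (z - x) - γ • ((B z - B x) + ε • (z - x)) := by
      module
    rw [e2]
    have h3 : ‖(B z - B x) + ε • (z - x)‖ ≤ (1 / β + ε) * ‖z - x‖ := by
      refine (norm_add_le _ _).trans ?_
      rw [norm_smul, Real.norm_of_nonneg hε.le, add_mul]
      linarith [hBlip z x]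
    calc _ ≤ ‖z - x‖ + ‖γ • ((B z - B x) + ε • (z - x))‖ := norm_sub_le _ _
      _ ≤ ‖z - x‖ + γ * ((1 / β + ε) * ‖z - x‖) := by
        rw [norm_smul, Real.norm_of_nonneg hγ.le]; gcongr
      _ = (1 + γ * (1 / β + ε)) * ‖z - x‖ := by ring
      _ ≤ _ := by gcongr
  refine squeeze_zero_norm' (eventually_nhdsWithin_of_forall key) ?_
  have hc : Continuous (fun p : ℝ × ℝ =>
      (1 + p.2 * (1 / β + p.1)) * (p.2 * ‖B x + p.1 • x + u‖)) := by fun_prop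
  have := hc.tendsto ((0:ℝ), (0:ℝ))
  simp only [zero_mul, mul_zero] at this
  exact this.mono_left nhdsWithin_le_nhds
end

section
/- Let H be a real Hilbert space, A : H → Set H monotone, B : H → H monotone, ε ≥ 0 and γ > 0. Let x, z, x̄ ∈ H satisfy (1/γ)·( x − γ·(B x + ε·x) − z ) ∈ A z and −B x̄ − ε·x̄ ∈ A x̄. Then 0 ≤ ‖x − x̄‖² − ‖x − z‖² − (1 + 2·ε·γ)·‖z − x̄‖² + 2γ·⟪ (B z + ε·z) − (B x + ε·x), z − x̄ ⟫. -/
open Filter MeasureTheory Set Topology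
open scoped RealInnerProductSpace

variable {H : Type*} [NormedAddCommGroup H] [InnerProductSpace ℝ H] [CompleteSpace H]

theorem stmt17 (A : H → Set H) (B : H → H)
    (hA : MonotoneSV A)
    (hBmono : ∀ x y : H, 0 ≤ ⟪B x - B y, x - y⟫)
    (ε γ : ℝ) (hε : 0 ≤ ε) (hγ : 0 < γ)
    (x z xbar : H)
    (hz : (1 / γ) • (x - γ • (B x + ε • x) - z) ∈ A z)
    (hxbar : -B xbar - ε • xbar ∈ A xbar) :
    0 ≤ ‖x - xbar‖ ^ 2 - ‖x - z‖ ^ 2 - (1 + 2 * ε * γ) * ‖z - xbar‖ ^ 2 +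
      2 * γ * ⟪(B z + ε • z) - (B x + ε • x), z - xbar⟫ := by
  have h1 := hA z xbar _ _ hz hxbar
  have h2 := hBmono z xbar
  have e1 : (1 / γ) • (x - γ • (B x + ε • x) - z) - (-B xbar - ε • xbar)
      = (1 / γ) • (x - z) + (((B z + ε • z) - (B x + ε • x)) - (B z - B xbar)
        - ε • (z - xbar)) := by
    have : (1 / γ) • (γ • (B x + ε • x)) = B x + ε • x := by
      rw [smul_smul, one_div, inv_mul_cancel₀ hγ.ne', one_smul]
    have e : x - γ • (B x + ε • x) - z = (x - z) - γ • (B x + ε • x) := by abel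
    rw [e, smul_sub, this]
    module
  rw [e1, inner_add_left, inner_sub_left, inner_sub_left, real_inner_smul_left,
    real_inner_smul_left, real_inner_self_eq_norm_sq] at h1
  have h3 : ‖x - xbar‖ ^ 2 = ‖x - z‖ ^ 2 + 2 * ⟪x - z, z - xbar⟫ + ‖z - xbar‖ ^ 2 := by
    rw [← norm_add_sq_real]
    congr 2
    abel
  have h4 := mul_nonneg hγ.le h1
  have h5 := mul_nonneg hγ.le h2
  have h6 : γ * (1 / γ * ⟪x - z, z - xbar⟫) = ⟪x - z, z - xbar⟫ := by
    field_simp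
  rw [mul_add, h6] at h4
  rw [h3]
  linarith
end

section
/- Let H be a real Hilbert space, A : H → Set H monotone, B : H → H monotone and (1/β)-Lipschitz continuous with β > 0, ε ≥ 0 and γ > 0. Let x, z, x̄ ∈ H satisfy (1/γ)·( x − γ·(B x + ε·x) − z ) ∈ A z and −B x̄ − ε·x̄ ∈ A x̄, and set v := z − x + γ·( B x − B z + ε·(x − z) ). Then ⟪x − x̄, v⟫ ≤ −(1 − γ·ε − γ/β)·‖x − z‖² − ε·γ·‖z − x̄‖². -/
open Filter MeasureTheory Set Topology
open scoped RealInnerProductSpace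

variable {H : Type*} [NormedAddCommGroup H] [InnerProductSpace ℝ H] [CompleteSpace H]

theorem stmt18 (A : H → Set H) (B : H → H) (β : ℝ) (hβ : 0 < β)
    (hA : MonotoneSV A)
    (hBmono : ∀ x y : H, 0 ≤ ⟪B x - B y, x - y⟫)
    (hBlip : ∀ x y : H, ‖B x - B y‖ ≤ (1 / β) * ‖x - y‖)
    (ε γ : ℝ) (hε : 0 ≤ ε) (hγ : 0 < γ)
    (x z xbar : H)
    (hz : (1 / γ) • (x - γ • (B x + ε • x) - z) ∈ A z)
    (hxbar : -B xbar - ε • xbar ∈ A xbar) :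
    ⟪x - xbar, z - x + γ • (B x - B z + ε • (x - z))⟫ ≤
      -(1 - γ * ε - γ / β) * ‖x - z‖ ^ 2 - ε * γ * ‖z - xbar‖ ^ 2 := by
  have h1 := hA _ _ _ _ hz hxbar
  have h2 := hBmono z xbar
  have h3 : ⟪x - z, B x - B z⟫ ≤ (1 / β) * ‖x - z‖ ^ 2 := by
    have ha := real_inner_le_norm (x - z) (B x - B z)
    have hb := mul_le_mul_of_nonneg_left (hBlip x z) (norm_nonneg (x - z))
    calc _ ≤ _ := ha
      _ ≤ _ := hb
      _ = _ := by ring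
  have h4 : (0 : ℝ) ≤ ⟪(x - z) - γ • (B x - B xbar) - (γ * ε) • (x - xbar), z - xbar⟫ := by
    have he : (x - z) - γ • (B x - B xbar) - (γ * ε) • (x - xbar)
        = γ • ((1 / γ) • (x - γ • (B x + ε • x) - z) - (-B xbar - ε • xbar)) := by
      rw [smul_sub γ ((1 / γ) • _), smul_smul, mul_one_div_cancel hγ.ne']
      module
    rw [he, real_inner_smul_left]
    exact mul_nonneg hγ.le h1
  have h5 := mul_nonneg hγ.le h2
  have h6 := mul_le_mul_of_nonneg_left h3 hγ.le
  have key : ⟪x - xbar, z - x + γ • (B x - B z + ε • (x - z))⟫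
      = -⟪(x - z) - γ • (B x - B xbar) - (γ * ε) • (x - xbar), z - xbar⟫
        - γ * ⟪B z - B xbar, z - xbar⟫ - (γ * ε) * ‖z - xbar‖ ^ 2
        - (1 - γ * ε) * ‖x - z‖ ^ 2 + γ * ⟪x - z, B x - B z⟫ := by
    have e1 : x - xbar = (x - z) + (z - xbar) := by abel
    have e2 : z - x = -(x - z) := by abel
    have e3 : B x - B xbar = (B x - B z) + (B z - B xbar) := by abel
    rw [e3, e1, e2]
    generalize x - z = d
    generalize z - xbar = w
    generalize B x - B z = p
    generalize B z - B xbar = q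
    simp only [inner_add_left, inner_add_right, inner_sub_left, inner_neg_right,
      real_inner_smul_left, real_inner_smul_right, ← real_inner_self_eq_norm_sq]
    rw [real_inner_comm d w, real_inner_comm p w]
    ring
  rw [key]
  have e : γ / β = γ * (1 / β) := by ring
  rw [e]
  nlinarith [h4, h5, h6]
end

section
/- Let H be a real Hilbert space, A : H → Set H maximally monotone, B : H → H monotone and (1/β)-Lipschitz continuous with β > 0, and Zer(A + B) nonempty. Let ε : [0, ∞) → (0, ∞) and γ : [0, ∞) → (0, ∞) be Lebesgue measurable with γ(t) < β/(ε(t)·β + 1) for all t ≥ 0, and for each t ≥ 0 let J_t : H → H be a resolvent of γ(t)·A. Let x : [0, ∞) → H and z : [0, ∞) → H be such that z(t) = J_t( x(t) − γ(t)·(B(x(t)) + ε(t)·x(t)) ) for all t ≥ 0 and x is a strong global solution of ẋ(t) = z(t) − x(t) + γ(t)·( B(x(t)) − B(z(t)) + ε(t)·(x(t) − z(t)) ), x(0) = x₀ ∈ H. Assume: (i) ε is locally absolutely continuous, nonincreasing and ε(t) → 0 as t → ∞; (ii) ε̇(t) / [ ε(t)²·γ(t)·( β·(1 − γ(t)·ε(t))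 − γ(t) ) ] → 0 as t → ∞; (iii) ∫₀^∞ γ(t)·ε(t)·( β − β·γ(t)·ε(t) − γ(t) ) / ( β·γ(t)·ε(t) + β + γ(t) ) dt = ∞. Then x(t) → P_{Zer(A+B)} 0 and z(t) → P_{Zer(A+B)} 0 strongly as t → ∞. -/
open Filter MeasureTheory Set Topology
open scoped RealInnerProductSpace

variable {H : Type*} [NormedAddCommGroup H] [InnerProductSpace ℝ H] [CompleteSpace H]

/-- `x` is a strong global solution of `ẋ(t) = f(t, x(t))`, `x(0) = x₀`, on `[0,∞)`. -/
def IsStrongGlobalSolution (f : ℝ → H → H) (x₀ : H) (x : ℝ → H) : Prop :=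
  ContinuousOn x (Set.Ici (0 : ℝ)) ∧
  (∀ b : ℝ, IntervalIntegrable (fun s => f s (x s)) volume 0 b) ∧
  ∀ t : ℝ, 0 ≤ t → x t = x₀ + ∫ s in (0:ℝ)..t, f s (x s)


set_option linter.unusedSectionVars false

theorem aux_resolvent_nonexp (A : H → Set H) (hA : MonotoneSV A) (g : ℝ) (hg : 0 < g)
    (w w' y y' : H) (h : (1 / g) • (w - y) ∈ A y) (h' : (1 / g) • (w' - y') ∈ A y') :
    ‖y - y'‖ ≤ ‖w - w'‖ := by
  have h1 := hA _ _ _ _ h h'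
  rw [← smul_sub, real_inner_smul_left] at h1
  have h2 : 0 ≤ ⟪(w - y) - (w' - y'), y - y'⟫ := by
    by_contra hc
    push Not at hc
    have : (1 / g) * ⟪(w - y) - (w' - y'), y - y'⟫ < 0 := mul_neg_of_pos_of_neg (by positivity) hc
    linarith
  have h3 : (w - y) - (w' - y') = (w - w') - (y - y') := by abel
  rw [h3, inner_sub_left, real_inner_self_eq_norm_sq] at h2
  have h4 := real_inner_le_norm (w - w') (y - y')
  by_contra hc
  push Not at hc
  nlinarith [norm_nonneg (w - w'), norm_nonneg (y - y')]

theorem aux_fixed (T : H → H) (k : ℝ) (hk0 : 0 ≤ k) (hk1 : k < 1)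
    (hT : ∀ a b, ‖T a - T b‖ ≤ k * ‖a - b‖) : ∃ y, T y = y := by
  have hc : ContractingWith ⟨k, hk0⟩ T := by
    refine ⟨by exact_mod_cast hk1, LipschitzWith.of_dist_le_mul fun a b => ?_⟩
    rw [dist_eq_norm, dist_eq_norm]
    exact hT a b
  obtain ⟨y, hy, -⟩ := hc.exists_fixedPoint (0 : H) (edist_ne_top _ _)
  exact ⟨y, hy⟩

theorem aux_reg_exists (A : H → Set H) (B : H → H) (β : ℝ) (hβ : 0 < β)
    (hA : MonotoneSV A)
    (hBmono : ∀ x y : H, 0 ≤ ⟪B x - B y, x - y⟫)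
    (hBlip : ∀ x y : H, ‖B x - B y‖ ≤ (1 / β) * ‖x - y‖)
    (g e : ℝ) (hg : 0 < g) (he : 0 < e) (hgβ : g < β) (hge : g * e < 1)
    (J : H → H) (hJ : ∀ w : H, (1 / g) • (w - J w) ∈ A (J w)) :
    ∃ y, -B y - e • y ∈ A y := by
  -- resolvent of A + B
  have hR : ∀ w, ∃ y, (1 / g) • (w - y) - B y ∈ A y := by
    intro w
    obtain ⟨y, hy⟩ := aux_fixed (fun y => J (w - g • B y)) (g / β) (by positivity)
      ((div_lt_one hβ).2 hgβ) (by
        intro a b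
        refine (aux_resolvent_nonexp A hA g hg _ _ _ _ (hJ _) (hJ _)).trans ?_
        have : w - g • B a - (w - g • B b) = -(g • (B a - B b)) := by
          rw [smul_sub]; abel
        rw [this, norm_neg, norm_smul, Real.norm_of_nonneg hg.le]
        calc g * ‖B a - B b‖ ≤ g * ((1 / β) * ‖a - b‖) := by gcongr; exact hBlip a b
          _ = g / β * ‖a - b‖ := by ring)
    have h := hJ (w - g • B y)
    rw [hy] at h
    refine ⟨y, ?_⟩
    convert h using 1
    rw [show w - g • B y - y = (w - y) - g • B y by abel, smul_sub (1 / g) (w - y), smul_smul,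
      one_div_mul_cancel hg.ne', one_smul]
  choose R hR using hR
  have hmono2 : MonotoneSV (fun y => {u | u - B y ∈ A y}) := by
    intro a b u v hu hv
    have h1 := hA _ _ _ _ hu hv
    have h2 := hBmono a b
    have : u - v = (u - B a - (v - B b)) + (B a - B b) := by abel
    rw [this, inner_add_left]
    linarith
  obtain ⟨y, hy⟩ := aux_fixed (fun y => R ((1 - g * e) • y)) (1 - g * e) (by linarith)
    (by nlinarith [mul_pos hg he]) (by
      intro a b
      refine (aux_resolvent_nonexp _ hmono2 g hg _ _ _ _ (hR _) (hR _)).trans ?_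
      rw [← smul_sub, norm_smul, Real.norm_of_nonneg (by linarith)])
  have h := hR ((1 - g * e) • y)
  rw [hy] at h
  refine ⟨y, ?_⟩
  convert h using 1
  have : (1 - g * e) • y - y = -((g * e) • y) := by rw [sub_smul, one_smul]; abel
  rw [this, smul_neg, smul_smul]
  have : 1 / g * (g * e) = e := by field_simp
  rw [this]; abel

/-- basic comparison of two regularized solutions -/
theorem aux_reg_cmp (A : H → Set H) (B : H → H)
    (hA : MonotoneSV A)
    (hBmono : ∀ x y : H, 0 ≤ ⟪B x - B y, x - y⟫)
    (e d : ℝ) (he : 0 ≤ e) (hd : 0 < d) (hed : e ≤ d) (a b : H)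
    (ha : -B a - e • a ∈ A a) (hb : -B b - d • b ∈ A b) :
    e * ‖a - b‖ ^ 2 ≤ (d - e) * ⟪b, a - b⟫ ∧ ‖a - b‖ ^ 2 ≤ ‖a‖ ^ 2 - ‖b‖ ^ 2 := by
  have h1 := hA _ _ _ _ ha hb
  have h2 := hBmono a b
  have h3 : -B a - e • a - (-B b - d • b) = -(B a - B b) - e • (a - b) + (d - e) • b := by
    rw [smul_sub, sub_smul]; abel
  rw [h3, inner_add_left, inner_sub_left, inner_neg_left, real_inner_smul_left,
    real_inner_smul_left, real_inner_self_eq_norm_sq] at h1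
  have h4 : e * ‖a - b‖ ^ 2 ≤ (d - e) * ⟪b, a - b⟫ := by linarith
  have h6 : ‖a‖ ^ 2 = ‖b‖ ^ 2 + 2 * ⟪b, a - b⟫ + ‖a - b‖ ^ 2 := by
    rw [← norm_add_sq_real]; congr 2; abel
  refine ⟨h4, ?_⟩
  rcases hed.lt_or_eq with hlt | rfl
  · have h5 : 0 ≤ ⟪b, a - b⟫ := by
      by_contra hc
      push Not at hc
      have := mul_neg_of_pos_of_neg (sub_pos.2 hlt) hc
      have : 0 ≤ e * ‖a - b‖ ^ 2 := by positivity
      linarith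
    linarith
  · have h7 : ‖a - b‖ ^ 2 ≤ 0 := by
      by_contra hc
      push Not at hc
      have := mul_pos hd hc
      linarith
    have h8 : a - b = 0 := by
      rw [← norm_eq_zero]; nlinarith [norm_nonneg (a - b)]
    rw [h8] at h6 ⊢
    simp at h6 ⊢
    rw [h6]

theorem aux_reg_lip (A : H → Set H) (B : H → H)
    (hA : MonotoneSV A)
    (hBmono : ∀ x y : H, 0 ≤ ⟪B x - B y, x - y⟫)
    (e d : ℝ) (he : 0 < e) (hed : e ≤ d) (a b : H)
    (ha : -B a - e • a ∈ A a) (hb : -B b - d • b ∈ A b) :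
    ‖a - b‖ ≤ (d - e) / e * ‖b‖ := by
  have h := (aux_reg_cmp A B hA hBmono e d he.le (he.trans_le hed) hed a b ha hb).1
  have h1 := real_inner_le_norm b (a - b)
  rw [div_mul_eq_mul_div, le_div_iff₀ he]
  by_contra hc
  push Not at hc
  have h2 : (d - e) * ⟪b, a - b⟫ ≤ (d - e) * (‖b‖ * ‖a - b‖) :=
    mul_le_mul_of_nonneg_left h1 (sub_nonneg.2 hed)
  have hn : 0 < ‖a - b‖ := by
    rcases (norm_nonneg (a - b)).eq_or_lt with h0 | h0
    · rw [← h0] at hc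
      have := mul_nonneg (sub_nonneg.2 hed) (norm_nonneg b)
      linarith
    · exact h0
  nlinarith [mul_lt_mul_of_pos_right hc hn]

/-- the dissipation estimate -/
theorem aux_dissip (A : H → Set H) (B : H → H) (β : ℝ) (hβ : 0 < β)
    (hA : MonotoneSV A)
    (hBmono : ∀ x y : H, 0 ≤ ⟪B x - B y, x - y⟫)
    (hBlip : ∀ x y : H, ‖B x - B y‖ ≤ (1 / β) * ‖x - y‖)
    (g e : ℝ) (hg : 0 < g) (he : 0 < e) (hgβ : g * (e * β + 1) < β)
    (x z y : H) (hz : (1 / g) • (x - g • (B x + e • x) - z) ∈ A z)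
    (hy : -B y - e • y ∈ A y) :
    ⟪z - x + g • (B x - B z + e • (x - z)), x - y⟫ ≤
      -(g * e * (β - β * g * e - g) / (β * g * e + β + g)) * ‖x - y‖ ^ 2 := by
  set v := z - x + g • (B x - B z + e • (x - z)) with hv
  have h1 := hA _ _ _ _ hz hy
  have h2 := hBmono z y
  have h3 : g • ((1 / g) • (x - g • (B x + e • x) - z) - (-B y - e • y)) =
      -v - g • (B z - B y) - (g * e) • (z - y) := by
    rw [smul_sub g, smul_smul, mul_one_div_cancel hg.ne', one_smul, hv]
    simp only [smul_sub, smul_add, smul_neg, smul_smul]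
    abel
  have h4 : 0 ≤ ⟪-v - g • (B z - B y) - (g * e) • (z - y), z - y⟫ := by
    rw [← h3, real_inner_smul_left]; positivity
  rw [inner_sub_left, inner_sub_left, inner_neg_left, real_inner_smul_left, real_inner_smul_left,
    real_inner_self_eq_norm_sq] at h4
  have h5 : ⟪v, z - y⟫ ≤ - (g * e * ‖z - y‖ ^ 2) := by
    have := mul_nonneg hg.le h2
    linarith
  have h6 : ⟪v, x - z⟫ = -‖x - z‖ ^ 2 + g * ⟪B x - B z, x - z⟫ + g * e * ‖x - z‖ ^ 2 := by
    rw [hv, inner_add_left, real_inner_smul_left, inner_add_left, real_inner_smul_left,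
      real_inner_self_eq_norm_sq, ← neg_sub x z, inner_neg_left, real_inner_self_eq_norm_sq]
    ring
  have h7 : ⟪B x - B z, x - z⟫ ≤ (1 / β) * ‖x - z‖ ^ 2 := by
    refine (real_inner_le_norm _ _).trans ?_
    nlinarith [hBlip x z, norm_nonneg (x - z)]
  have h8 : ⟪v, x - y⟫ = ⟪v, z - y⟫ + ⟪v, x - z⟫ := by
    rw [← inner_add_right]; congr 1; abel
  have h9 : ‖x - y‖ ≤ ‖x - z‖ + ‖z - y‖ := norm_sub_le_norm_sub_add_norm_sub x z y
  have h10 := mul_le_mul_of_nonneg_left h7 hg.le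
  set p := ‖x - z‖
  set q := ‖z - y‖
  set r := ‖x - y‖ with hr
  have hp : 0 ≤ p := norm_nonneg _
  have hq : 0 ≤ q := norm_nonneg _
  have hr0 : 0 ≤ r := norm_nonneg _
  have h11 : ⟪v, x - y⟫ ≤ -(g * e * q ^ 2) - (1 - g * e - g / β) * p ^ 2 := by
    rw [h8, h6]
    have : g * (1 / β * p ^ 2) = g / β * p ^ 2 := by ring
    linarith
  refine h11.trans ?_
  set D := β - β * g * e - g with hD
  have hDpos : 0 < D := by rw [hD]; nlinarith
  have hS : 0 < β * g * e + β + g := by positivity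
  have hge : 0 < g * e := mul_pos hg he
  have e1 : 1 - g * e - g / β = D / β := by rw [hD]; field_simp
  rw [e1]
  have key : g * e * D / (β * g * e + β + g) * r ^ 2 ≤ g * e * q ^ 2 + D / β * p ^ 2 := by
    have hr2 : r ^ 2 ≤ (p + q) ^ 2 := by gcongr
    have k1 : g * e * D / (β * g * e + β + g) ≤ g * e * D / (β * (g * e) + D) := by
      apply div_le_div_of_nonneg_left (by positivity) (by positivity)
      rw [hD]; nlinarith
    have k2 : g * e * D / (β * (g * e) + D) * (p + q) ^ 2 ≤ g * e * q ^ 2 + D / β * p ^ 2 := by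
      rw [div_mul_eq_mul_div, div_le_iff₀ (by positivity)]
      have : (g * e * q ^ 2 + D / β * p ^ 2) * (β * (g * e) + D) - g * e * D * (p + q) ^ 2
          = (β * (g * e) * q - D * p) ^ 2 / β := by
        field_simp; ring
      have : 0 ≤ (β * (g * e) * q - D * p) ^ 2 / β := by positivity
      linarith
    calc _ ≤ g * e * D / (β * (g * e) + D) * r ^ 2 := by gcongr
      _ ≤ g * e * D / (β * (g * e) + D) * (p + q) ^ 2 := by gcongr
      _ ≤ _ := k2
  linarith

theorem aux_ac (f G : ℝ → ℝ) (a b : ℝ) (hG : AbsolutelyContinuousOnInterval G a b)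
    (h : ∀ s ∈ uIcc a b, ∀ t ∈ uIcc a b, |f s - f t| ≤ |G s - G t|) :
    AbsolutelyContinuousOnInterval f a b := by
  unfold AbsolutelyContinuousOnInterval at *
  refine squeeze_zero' (Eventually.of_forall fun E => Finset.sum_nonneg fun _ _ => dist_nonneg)
    ?_ hG
  have : ∀ᶠ E in (AbsolutelyContinuousOnInterval.totalLengthFilter ⊓
    𝓟 (AbsolutelyContinuousOnInterval.disjWithin a b)),
      E ∈ AbsolutelyContinuousOnInterval.disjWithin a b :=
    eventually_inf_principal.2 (Eventually.of_forall fun _ h => h)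
  filter_upwards [this] with E hE
  refine Finset.sum_le_sum fun i hi => ?_
  rw [Real.dist_eq, Real.dist_eq]
  exact h _ (hE.1 i hi).1 _ (hE.1 i hi).2

theorem aux_decrease (f g : ℝ → ℝ) (a b : ℝ) (hab : a ≤ b)
    (hf : AbsolutelyContinuousOnInterval f a b) (hg : IntervalIntegrable g volume a b)
    (h : ∀ᵐ t, t ∈ Ioo a b → deriv f t ≤ g t) : f b ≤ f a + ∫ t in a..b, g t := by
  have h1 := hf.integral_deriv_eq_sub
  have h2 : ∫ t in a..b, deriv f t ≤ ∫ t in a..b, g t := by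
    apply intervalIntegral.integral_mono_ae_restrict hab hf.intervalIntegrable_deriv hg
    rw [Filter.EventuallyLE, ← restrict_Ioo_eq_restrict_Icc, ae_restrict_iff' measurableSet_Ioo]
    exact h
  linarith

theorem aux_diverge (θ : ℝ → ℝ) (hθm : Measurable θ) (hθ0 : ∀ t, 0 ≤ t → 0 ≤ θ t)
    (hθint : ∀ a b, 0 ≤ a → 0 ≤ b → IntervalIntegrable θ volume a b)
    (htop : ∫⁻ t in Set.Ioi (0:ℝ), ENNReal.ofReal (θ t) = ⊤) (T C : ℝ) (hT : 0 ≤ T) :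
    ∃ t, T ≤ t ∧ C < ∫ s in T..t, θ s := by
  by_contra hc
  push Not at hc
  have h1 : IntegrableOn θ (Ioi T) := by
    refine integrableOn_Ioi_of_intervalIntegral_norm_bounded (l := atTop) (b := fun n : ℝ => n)
      C T (fun i => ?_) tendsto_id ?_
    · rcases le_total T i with h | h
      · exact (intervalIntegrable_iff_integrableOn_Ioc_of_le h).1 (hθint T i hT (hT.trans h))
      · simp [h]
    · filter_upwards [eventually_ge_atTop T] with t ht
      refine le_trans (le_of_eq ?_) (hc t ht)
      apply intervalIntegral.integral_congr
      intro s hs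
      rw [uIcc_of_le ht] at hs
      exact Real.norm_of_nonneg (hθ0 s (hT.trans hs.1))
  have h2 : IntegrableOn θ (Ioi 0) := by
    rw [← Ioc_union_Ioi_eq_Ioi hT]
    exact ((intervalIntegrable_iff_integrableOn_Ioc_of_le hT).1 (hθint 0 T le_rfl hT)).union h1
  have h3 := h2.lintegral_lt_top
  rw [htop] at h3
  exact lt_irrefl _ h3

theorem aux_gronwall (θ h : ℝ → ℝ) (hθm : Measurable θ) (hθ0 : ∀ t, 0 ≤ t → 0 ≤ θ t)
    (hθint : ∀ a b, 0 ≤ a → 0 ≤ b → IntervalIntegrable θ volume a b)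
    (htop : ∫⁻ t in Set.Ioi (0:ℝ), ENNReal.ofReal (θ t) = ⊤) (T δ : ℝ) (hT : 0 ≤ T)
    (hδ : 0 < δ) (hcont : ContinuousOn h (Ici 0)) (hh0 : ∀ t, 0 ≤ t → 0 ≤ h t)
    (hdec : ∀ s t, T ≤ s → s ≤ t → (∀ r ∈ Icc s t, 2 * δ ≤ h r) →
      h t ≤ h s - δ * ∫ r in s..t, θ r) :
    ∃ T', 0 ≤ T' ∧ ∀ t, T' ≤ t → h t ≤ 2 * δ := by
  have h1 : ∃ T', T ≤ T' ∧ h T' ≤ 2 * δ := by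
    by_contra hc
    push Not at hc
    obtain ⟨t, ht, hC⟩ := aux_diverge θ hθm hθ0 hθint htop T (h T / δ) hT
    have h2 := hdec T t le_rfl ht (fun r hr => (hc r hr.1).le)
    have h3 := hh0 t (hT.trans ht)
    rw [div_lt_iff₀ hδ] at hC
    linarith
  obtain ⟨T', hTT', hT'⟩ := h1
  have hT'0 := hT.trans hTT'
  refine ⟨T', hT'0, fun t ht => ?_⟩
  by_contra hc
  push Not at hc
  have hco : ContinuousOn h (Icc T' t) := hcont.mono fun r hr => hT'0.trans hr.1
  have hclosed : IsClosed (Icc T' t ∩ h ⁻¹' Iic (2 * δ)) :=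
    hco.preimage_isClosed_of_isClosed isClosed_Icc isClosed_Iic
  have hcomp : IsCompact (Icc T' t ∩ h ⁻¹' Iic (2 * δ)) :=
    isCompact_Icc.of_isClosed_subset hclosed inter_subset_left
  obtain ⟨s, ⟨hs1, hs2⟩, hs3⟩ := hcomp.exists_isGreatest ⟨T', ⟨le_rfl, ht⟩, hT'⟩
  have hs2' : h s ≤ 2 * δ := hs2
  have hst : s < t := lt_of_le_of_ne hs1.2 (by rintro rfl; linarith)
  have hgt : ∀ r ∈ Ioc s t, 2 * δ < h r := by
    intro r hr
    by_contra hc'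
    push Not at hc'
    exact absurd (hs3 ⟨⟨hs1.1.trans hr.1.le, hr.2⟩, hc'⟩) (not_le.2 hr.1)
  have hge : ∀ r ∈ Icc s t, 2 * δ ≤ h r := by
    intro r hr
    rcases hr.1.eq_or_lt with rfl | h'
    · have hcs : Tendsto h (𝓝[>] s) (𝓝 (h s)) :=
        (hco s hs1).mono_left (nhdsWithin_le_of_mem (by
          filter_upwards [Ioc_mem_nhdsGT hst] with r hr
          exact ⟨hs1.1.trans hr.1.le, hr.2⟩))
      refine ge_of_tendsto hcs ?_
      filter_upwards [Ioc_mem_nhdsGT hst] with r hr using (hgt r hr).le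
    · exact (hgt r ⟨h', hr.2⟩).le
  have h4 := hdec s t (hTT'.trans hs1.1) hst.le hge
  have h5 : 0 ≤ ∫ r in s..t, θ r :=
    intervalIntegral.integral_nonneg hst.le fun r hr => hθ0 r (hT'0.trans (hs1.1.trans hr.1))
  have := mul_nonneg hδ.le h5
  linarith

theorem aux_deriv (x Y : ℝ → H) (eps h : ℝ → ℝ) (P t : ℝ) (v : H) (e' h' : ℝ)
    (hx : HasDerivAt x v t) (heps : HasDerivAt eps e' t) (hh : HasDerivAt h h' t)
    (hpos : 0 < eps t)
    (hdef : ∀ s, t ≤ s → h s = ‖x s - Y s‖ ^ 2)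
    (hY : ∀ s, t ≤ s → ‖Y s - Y t‖ ≤ (eps t - eps s) / eps s * P) :
    h' ≤ 2 * ⟪v, x t - Y t⟫ + 2 * ‖x t - Y t‖ * (-e' / eps t * P) := by
  set k : ℝ → ℝ := fun s => (eps t - eps s) / eps s * P with hk
  set m : ℝ → ℝ := fun s => ‖x s - Y t‖ ^ 2 with hm
  have hkt : k t = 0 := by simp [hk]
  have hkd : HasDerivAt k (-e' / eps t * P) t := by
    have h1 := (((hasDerivAt_const t (eps t)).sub heps).div heps hpos.ne').mul_const P
    refine h1.congr_deriv ?_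
    simp only [Pi.sub_apply]
    field_simp
    ring
  have hmd : HasDerivAt m (2 * ⟪v, x t - Y t⟫) t := by
    have h1 := (hx.sub_const (Y t)).norm_sq
    refine h1.congr_deriv ?_
    rw [real_inner_comm]
  have sub : 𝓝[>] t ≤ 𝓝[≠] t := nhdsWithin_mono _ fun s hs => ne_of_gt hs
  have t1 := hh.tendsto_slope.mono_left sub
  have t2 := hmd.tendsto_slope.mono_left sub
  have t3 := hkd.tendsto_slope.mono_left sub
  have t4 : Tendsto (fun s => 2 * ‖x s - Y t‖ + k s) (𝓝[>] t) (𝓝 (2 * ‖x t - Y t‖ + k t)) :=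
    ((((hx.continuousAt.sub continuousAt_const).norm.const_mul 2).add
      hkd.continuousAt).tendsto).mono_left nhdsWithin_le_nhds
  have t5 := t2.add (t4.mul t3)
  rw [hkt, add_zero] at t5
  refine le_of_tendsto_of_tendsto t1 t5 ?_
  filter_upwards [self_mem_nhdsWithin] with s hs
  have hs' : t < s := hs
  rw [slope_def_field, slope_def_field, slope_def_field, hkt, hdef s hs'.le, hdef t le_rfl]
  have hst : 0 < s - t := sub_pos.2 hs'
  rw [mul_div_assoc', ← add_div]
  refine div_le_div_of_nonneg_right ?_ hst.le
  have a1 : ‖x s - Y s‖ ≤ ‖x s - Y t‖ + k s := by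
    refine (norm_sub_le_norm_sub_add_norm_sub (x s) (Y t) (Y s)).trans ?_
    gcongr
    rw [norm_sub_rev]
    exact hY s hs'.le
  have a2 : ‖x s - Y s‖ ^ 2 ≤ (‖x s - Y t‖ + k s) ^ 2 := by gcongr
  simp only [hm]
  nlinarith

theorem aux_z_bound (A : H → Set H) (B : H → H) (β : ℝ) (hβ : 0 < β)
    (hA : MonotoneSV A)
    (hBlip : ∀ x y : H, ‖B x - B y‖ ≤ (1 / β) * ‖x - y‖)
    (g e : ℝ) (hg : 0 < g) (he : 0 < e) (hgβ : g < β) (hge : g * e < 1)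
    (x z y : H) (hz : (1 / g) • (x - g • (B x + e • x) - z) ∈ A z)
    (hy : -B y - e • y ∈ A y) : ‖z - y‖ ≤ 3 * ‖x - y‖ := by
  have hy' : (1 / g) • (y - g • (B y + e • y) - y) ∈ A y := by
    convert hy using 1
    rw [show y - g • (B y + e • y) - y = g • (-B y - e • y) by
      simp only [smul_add, smul_sub, smul_neg]; abel, smul_smul, one_div_mul_cancel hg.ne',
      one_smul]
  refine (aux_resolvent_nonexp A hA g hg _ _ _ _ hz hy').trans ?_
  have e1 : x - g • (B x + e • x) - (y - g • (B y + e • y)) =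
      (x - y) - g • (B x - B y) - (g * e) • (x - y) := by
    simp only [smul_add, smul_sub, smul_smul]; abel
  rw [e1]
  refine (norm_sub_le _ _).trans ?_
  have h1 := norm_sub_le (x - y) (g • (B x - B y))
  have h2 : ‖g • (B x - B y)‖ ≤ ‖x - y‖ := by
    rw [norm_smul, Real.norm_of_nonneg hg.le]
    calc g * ‖B x - B y‖ ≤ g * ((1 / β) * ‖x - y‖) := by gcongr; exact hBlip _ _
      _ = g / β * ‖x - y‖ := by ring
      _ ≤ 1 * ‖x - y‖ := by gcongr; exact ((div_lt_one hβ).2 hgβ).le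
      _ = _ := one_mul _
  have h3 : ‖(g * e) • (x - y)‖ ≤ ‖x - y‖ := by
    rw [norm_smul, Real.norm_of_nonneg (by positivity)]
    nlinarith [norm_nonneg (x - y)]
  linarith

theorem aux_path_limit (A : H → Set H) (B : H → H) (β : ℝ) (hβ : 0 < β)
    (hA : MaximallyMonotone A)
    (hBmono : ∀ x y : H, 0 ≤ ⟪B x - B y, x - y⟫)
    (hBlip : ∀ x y : H, ‖B x - B y‖ ≤ (1 / β) * ‖x - y‖)
    (hZer : {w : H | -B w ∈ A w}.Nonempty)
    (eps : ℝ → ℝ) (heps_pos : ∀ t : ℝ, 0 ≤ t → 0 < eps t)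
    (heps_mono : ∀ s t : ℝ, 0 ≤ s → s ≤ t → eps t ≤ eps s)
    (heps_lim : Tendsto eps atTop (𝓝 (0:ℝ))) (Y : ℝ → H)
    (hY : ∀ t, 0 ≤ t → -B (Y t) - eps t • Y t ∈ A (Y t)) :
    ∃ p, -B p ∈ A p ∧ (∀ q : H, -B q ∈ A q → ‖p‖ ≤ ‖q‖) ∧ Tendsto Y atTop (𝓝 p) := by
  have hbd : ∀ q, -B q ∈ A q → ∀ t, 0 ≤ t → ‖Y t‖ ≤ ‖q‖ := by
    intro q hq t ht
    have h := (aux_reg_cmp A B hA.1 hBmono 0 (eps t) le_rfl (heps_pos t ht) (heps_pos t ht).le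
      q (Y t) (by simpa using hq) (hY t ht)).2
    have h2 := sq_nonneg ‖q - Y t‖
    exact abs_le_of_sq_le_sq' (by linarith) (norm_nonneg _) |>.2
  have hcmp : ∀ s t, 0 ≤ s → s ≤ t → ‖Y t - Y s‖ ^ 2 ≤ ‖Y t‖ ^ 2 - ‖Y s‖ ^ 2 := fun s t hs hst =>
    (aux_reg_cmp A B hA.1 hBmono (eps t) (eps s) (heps_pos t (hs.trans hst)).le (heps_pos s hs)
      (heps_mono s t hs hst) _ _ (hY t (hs.trans hst)) (hY s hs)).2
  obtain ⟨q, hq⟩ := hZer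
  set n : ℝ → ℝ := fun t => ‖Y (max t 0)‖ ^ 2 with hn
  have hnm : Monotone n := by
    intro s t hst
    have h := hcmp (max s 0) (max t 0) (le_max_right _ _) (max_le_max_right 0 hst)
    have h2 := sq_nonneg ‖Y (max t 0) - Y (max s 0)‖
    simp only [hn]
    linarith
  have hnb : BddAbove (range n) := by
    refine ⟨‖q‖ ^ 2, ?_⟩
    rintro _ ⟨t, rfl⟩
    have := hbd q hq (max t 0) (le_max_right _ _)
    simp only [hn]
    gcongr
  have hnlim := tendsto_atTop_ciSup hnm hnb
  have hcau : CauchySeq Y := by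
    rw [Metric.cauchySeq_iff']
    intro ε hε
    have h1 : ∀ᶠ t in atTop, (⨆ i, n i) - ε ^ 2 < n t :=
      hnlim.eventually (lt_mem_nhds (by have := pow_pos hε 2; linarith))
    obtain ⟨T, hT1, hT0⟩ := (h1.and (eventually_ge_atTop 0)).exists
    refine ⟨T, fun t ht => ?_⟩
    have ht' : T ≤ t := ht
    have h2 := hcmp T t hT0 ht'
    have h3 : n t ≤ ⨆ i, n i := le_ciSup hnb t
    simp only [hn, max_eq_left hT0, max_eq_left (hT0.trans ht')] at h3 hT1
    rw [dist_eq_norm]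
    refine lt_of_pow_lt_pow_left₀ 2 hε.le ?_
    linarith
  obtain ⟨p, hp⟩ := cauchySeq_tendsto_of_complete hcau
  have hBc : Continuous B := by
    have : LipschitzWith ⟨1 / β, by positivity⟩ B := LipschitzWith.of_dist_le_mul fun a b => by
      rw [dist_eq_norm, dist_eq_norm]; exact hBlip a b
    exact this.continuous
  refine ⟨p, ?_, ?_, hp⟩
  · apply hA.2
    intro y v hv
    have h1 : Tendsto (fun t => ⟪-B (Y t) - eps t • Y t - v, Y t - y⟫) atTop
        (𝓝 ⟪-B p - (0:ℝ) • p - v, p - y⟫) :=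
      (((((hBc.tendsto p).comp hp).neg.sub (heps_lim.smul hp)).sub tendsto_const_nhds).inner
        (hp.sub tendsto_const_nhds))
    rw [zero_smul, sub_zero] at h1
    refine ge_of_tendsto h1 ?_
    filter_upwards [eventually_ge_atTop 0] with t ht
    exact hA.1 _ _ _ _ (hY t ht) hv
  · intro q hq
    refine le_of_tendsto hp.norm ?_
    filter_upwards [eventually_ge_atTop 0] with t ht using hbd q hq t ht

/-- local absolute continuity of the squared distance -/
theorem aux_h_ac (x Y F : ℝ → H) (x₀ : H) (eps epsd : ℝ → ℝ) (P b : ℝ) (hb : 0 ≤ b)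
    (hxc : ContinuousOn x (Ici 0))
    (hF : ∀ b : ℝ, IntervalIntegrable F volume 0 b)
    (hx : ∀ t : ℝ, 0 ≤ t → x t = x₀ + ∫ s in (0:ℝ)..t, F s)
    (heps_pos : ∀ t : ℝ, 0 ≤ t → 0 < eps t)
    (hepsd_int : ∀ b : ℝ, IntervalIntegrable epsd volume 0 b)
    (hepsAC : ∀ t : ℝ, 0 ≤ t → eps t = eps 0 + ∫ s in (0:ℝ)..t, epsd s)
    (heps_mono : ∀ s t : ℝ, 0 ≤ s → s ≤ t → eps t ≤ eps s) (hP : 0 ≤ P)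
    (hYP : ∀ t, 0 ≤ t → ‖Y t‖ ≤ P)
    (hY : ∀ s t, 0 ≤ s → s ≤ t → ‖Y t - Y s‖ ≤ (eps s - eps t) / eps t * P) :
    AbsolutelyContinuousOnInterval (fun t => ‖x t - Y t‖ ^ 2) 0 b := by
  obtain ⟨M, hM⟩ := isCompact_Icc.exists_bound_of_continuousOn
    (hxc.mono (fun r hr => hr.1 : Icc 0 b ⊆ Ici 0))
  set C := 2 * (M + P) with hC
  have hM0 : 0 ≤ M := (norm_nonneg _).trans (hM 0 ⟨le_rfl, hb⟩)
  have hC0 : 0 ≤ C := by positivity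
  have heb := heps_pos b hb
  set g : ℝ → ℝ := fun s => C * ‖F s‖ + (C * P / eps b) * |epsd s| with hg
  have hg0 : ∀ s, 0 ≤ g s := fun s => by positivity
  have hFn : ∀ c, IntervalIntegrable (fun s => ‖F s‖) volume 0 c := fun c => (hF c).norm
  have hEn : ∀ c, IntervalIntegrable (fun s => |epsd s|) volume 0 c := fun c => (hepsd_int c).abs
  have hgi : ∀ c, IntervalIntegrable g volume 0 c := fun c =>
    ((hFn c).const_mul C).add ((hEn c).const_mul _)
  have hsub : ∀ {f : ℝ → ℝ}, (∀ c, IntervalIntegrable f volume 0 c) →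
      ∀ s t, IntervalIntegrable f volume s t := fun h s t => (h s).symm.trans (h t)
  have key : ∀ s ∈ Icc 0 b, ∀ t ∈ Icc 0 b, s ≤ t →
      |‖x t - Y t‖ ^ 2 - ‖x s - Y s‖ ^ 2| ≤ |(∫ r in (0:ℝ)..t, g r) - ∫ r in (0:ℝ)..s, g r| := by
    intro s hs t ht hst
    have i0 : (∫ r in (0:ℝ)..t, g r) - ∫ r in (0:ℝ)..s, g r = ∫ r in s..t, g r :=
      intervalIntegral.integral_interval_sub_left (hgi t) (hgi s)
    rw [i0]
    refine le_trans ?_ (le_abs_self _)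
    have i1 : ∫ r in s..t, g r = C * (∫ r in s..t, ‖F r‖) + (C * P / eps b) *
        ∫ r in s..t, |epsd r| := by
      simp only [hg]
      rw [intervalIntegral.integral_add ((hsub hFn s t).const_mul C)
        ((hsub hEn s t).const_mul _), intervalIntegral.integral_const_mul,
        intervalIntegral.integral_const_mul]
    have i2 : ‖x t - x s‖ ≤ ∫ r in s..t, ‖F r‖ := by
      rw [hx t ht.1, hx s hs.1, add_sub_add_left_eq_sub,
        intervalIntegral.integral_interval_sub_left (hF t) (hF s)]
      exact intervalIntegral.norm_integral_le_integral_norm hst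
    have i3 : eps s - eps t ≤ ∫ r in s..t, |epsd r| := by
      have : eps t - eps s = ∫ r in s..t, epsd r := by
        rw [hepsAC t ht.1, hepsAC s hs.1, add_sub_add_left_eq_sub,
          intervalIntegral.integral_interval_sub_left (hepsd_int t) (hepsd_int s)]
      have h2 := intervalIntegral.norm_integral_le_integral_norm (f := epsd) (μ := volume) hst
      rw [← this] at h2
      simp only [Real.norm_eq_abs] at h2
      rw [abs_sub_comm] at h2
      exact (le_abs_self _).trans h2
    have i4 : ‖Y t - Y s‖ ≤ P / eps b * ∫ r in s..t, |epsd r| := by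
      refine (hY s t hs.1 hst).trans ?_
      have h1 : 0 ≤ eps s - eps t := sub_nonneg.2 (heps_mono s t hs.1 hst)
      have h2 : (eps s - eps t) / eps t ≤ (∫ r in s..t, |epsd r|) / eps b :=
        div_le_div₀ (h1.trans i3) i3 heb (heps_mono t b ht.1 ht.2)
      calc _ ≤ (∫ r in s..t, |epsd r|) / eps b * P := by gcongr
        _ = _ := by ring
    have i5 : |‖x t - Y t‖ - ‖x s - Y s‖| ≤ ‖x t - x s‖ + ‖Y t - Y s‖ := by
      refine (abs_norm_sub_norm_le _ _).trans ?_
      rw [show x t - Y t - (x s - Y s) = (x t - x s) - (Y t - Y s) by abel]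
      exact norm_sub_le _ _
    have i6 : ∀ r ∈ Icc 0 b, ‖x r - Y r‖ ≤ M + P := fun r hr =>
      (norm_sub_le _ _).trans (add_le_add (hM r hr) (hYP r hr.1))
    rw [sq_sub_sq, abs_mul, i1]
    have i7 : |‖x t - Y t‖ + ‖x s - Y s‖| ≤ C := by
      rw [abs_of_nonneg (by positivity), hC]
      linarith [i6 t ht, i6 s hs]
    calc _ ≤ C * ((∫ r in s..t, ‖F r‖) + P / eps b * ∫ r in s..t, |epsd r|) :=
          mul_le_mul i7 (i5.trans (add_le_add i2 i4)) (abs_nonneg _) hC0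
      _ = _ := by ring
  refine aux_ac _ (fun t => ∫ r in (0:ℝ)..t, g r) 0 b
    ((hgi b).absolutelyContinuousOnInterval_intervalIntegral left_mem_uIcc) ?_
  rw [uIcc_of_le hb]
  intro s hs t ht
  rcases le_total s t with h | h
  · rw [abs_sub_comm, abs_sub_comm (∫ r in (0:ℝ)..s, g r)]
    exact key s hs t ht h
  · exact key t ht s hs h

theorem aux_ae_deriv {E : Type*} [NormedAddCommGroup E] [NormedSpace ℝ E] [CompleteSpace E]
    (x F : ℝ → E) (x₀ : E) (hF : ∀ b : ℝ, IntervalIntegrable F volume 0 b)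
    (hx : ∀ t : ℝ, 0 ≤ t → x t = x₀ + ∫ s in (0:ℝ)..t, F s) (b : ℝ) :
    ∀ᵐ t, t ∈ Ioo 0 b → HasDerivAt x (F t) t := by
  filter_upwards [(hF b).ae_hasDerivAt_integral] with t ht htb
  have h1 := (ht (by rw [uIcc_of_le (htb.1.trans htb.2).le]; exact ⟨htb.1.le, htb.2.le⟩) 0
    left_mem_uIcc).const_add x₀
  refine h1.congr_of_eventuallyEq ?_
  filter_upwards [lt_mem_nhds htb.1] with s hs using hx s (le_of_lt hs)

theorem stmt19 (A : H → Set H) (B : H → H) (β : ℝ) (hβ : 0 < β)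
    (hA : MaximallyMonotone A)
    (hBmono : ∀ x y : H, 0 ≤ ⟪B x - B y, x - y⟫)
    (hBlip : ∀ x y : H, ‖B x - B y‖ ≤ (1 / β) * ‖x - y‖)
    (hZer : {w : H | -B w ∈ A w}.Nonempty)
    (eps γ : ℝ → ℝ) (heps_meas : Measurable eps) (hγ_meas : Measurable γ)
    (heps_pos : ∀ t : ℝ, 0 ≤ t → 0 < eps t)
    (hγ_pos : ∀ t : ℝ, 0 ≤ t → 0 < γ t)
    (hγβ : ∀ t : ℝ, 0 ≤ t → γ t < β / (eps t * β + 1))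
    (J : ℝ → H → H)
    (hJ : ∀ t : ℝ, 0 ≤ t → ∀ w : H, (1 / γ t) • (w - J t w) ∈ A (J t w))
    (x₀ : H) (x z : ℝ → H)
    (hz : ∀ t : ℝ, 0 ≤ t → z t = J t (x t - γ t • (B (x t) + eps t • x t)))
    (hsol : IsStrongGlobalSolution
      (fun t w => z t - w + γ t • (B w - B (z t) + eps t • (w - z t))) x₀ x)
    -- (i) ε is locally absolutely continuous (with derivative epsd),
    -- nonincreasing, and ε(t) → 0 as t → ∞
    (epsd : ℝ → ℝ)
    (hepsd_int : ∀ b : ℝ, IntervalIntegrable epsd volume 0 b)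
    (hepsAC : ∀ t : ℝ, 0 ≤ t → eps t = eps 0 + ∫ s in (0:ℝ)..t, epsd s)
    (heps_mono : ∀ s t : ℝ, 0 ≤ s → s ≤ t → eps t ≤ eps s)
    (heps_lim : Tendsto eps atTop (𝓝 (0:ℝ)))
    -- (ii) ε̇(t) / [ε(t)²·γ(t)·(β·(1 − γ(t)·ε(t)) − γ(t))] → 0 as t → ∞
    (hii : Tendsto
      (fun t => epsd t / (eps t ^ 2 * γ t * (β * (1 - γ t * eps t) - γ t)))
      atTop (𝓝 (0:ℝ)))
    -- (iii) ∫₀^∞ γ(t)·ε(t)·(β − β·γ(t)·ε(t) − γ(t)) / (β·γ(t)·ε(t) + β + γ(t)) dt = ∞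
    (hiii : ∫⁻ t in Set.Ioi (0:ℝ),
      ENNReal.ofReal (γ t * eps t * (β - β * γ t * eps t - γ t) /
        (β * γ t * eps t + β + γ t)) = ⊤) :
    ∃ p : H, -B p ∈ A p ∧ (∀ q : H, -B q ∈ A q → ‖p‖ ≤ ‖q‖) ∧
      Tendsto x atTop (𝓝 p) ∧ Tendsto z atTop (𝓝 p) := by
  have hgb : ∀ t, 0 ≤ t → γ t * (eps t * β + 1) < β := fun t ht => by
    have := hγβ t ht
    rwa [lt_div_iff₀ (by have := heps_pos t ht; positivity)] at this
  have hprod : ∀ t, 0 ≤ t → 0 < γ t * eps t := fun t ht => mul_pos (hγ_pos t ht) (heps_pos t ht)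
  have hgβ' : ∀ t, 0 ≤ t → γ t < β := fun t ht => by
    have := hgb t ht
    have := mul_pos (hprod t ht) hβ
    nlinarith
  have hge : ∀ t, 0 ≤ t → γ t * eps t < 1 := fun t ht => by
    have h1 := hgb t ht
    have h2 := hγ_pos t ht
    by_contra hc
    push Not at hc
    nlinarith
  have hYex : ∀ t, ∃ y, 0 ≤ t → -B y - eps t • y ∈ A y := by
    intro t
    by_cases ht : 0 ≤ t
    · obtain ⟨y, hy⟩ := aux_reg_exists A B β hβ hA.1 hBmono hBlip (γ t) (eps t) (hγ_pos t ht)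
        (heps_pos t ht) (hgβ' t ht) (hge t ht) (J t) (hJ t ht)
      exact ⟨y, fun _ => hy⟩
    · exact ⟨0, fun h => absurd h ht⟩
  choose Y hY using hYex
  obtain ⟨p, hpz, hpmin, hYp⟩ := aux_path_limit A B β hβ hA hBmono hBlip hZer eps heps_pos
    heps_mono heps_lim Y hY
  set P := ‖p‖ with hP
  have hP0 : 0 ≤ P := norm_nonneg _
  have hYP : ∀ t, 0 ≤ t → ‖Y t‖ ≤ P := by
    intro t ht
    have h := (aux_reg_cmp A B hA.1 hBmono 0 (eps t) le_rfl (heps_pos t ht) (heps_pos t ht).le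
      p (Y t) (by simpa using hpz) (hY t ht)).2
    have h2 := sq_nonneg ‖p - Y t‖
    exact abs_le_of_sq_le_sq' (by linarith) (norm_nonneg _) |>.2
  have hYlip : ∀ s t, 0 ≤ s → s ≤ t → ‖Y t - Y s‖ ≤ (eps s - eps t) / eps t * P := by
    intro s t hs hst
    have ht := hs.trans hst
    refine (aux_reg_lip A B hA.1 hBmono (eps t) (eps s) (heps_pos t ht) (heps_mono s t hs hst)
      _ _ (hY t ht) (hY s hs)).trans ?_
    have h1 : 0 ≤ (eps s - eps t) / eps t :=
      div_nonneg (sub_nonneg.2 (heps_mono s t hs hst)) (heps_pos t ht).le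
    exact mul_le_mul_of_nonneg_left (hYP s hs) h1
  have hzA : ∀ t, 0 ≤ t → (1 / γ t) • (x t - γ t • (B (x t) + eps t • x t) - z t) ∈ A (z t) := by
    intro t ht
    have h := hJ t ht (x t - γ t • (B (x t) + eps t • x t))
    rwa [← hz t ht] at h
  obtain ⟨hxc, hF, hx⟩ := hsol
  set F : ℝ → H := fun s => z s - x s + γ s • (B (x s) - B (z s) + eps s • (x s - z s)) with hFdef
  set θ : ℝ → ℝ := fun t => γ t * eps t * (β - β * γ t * eps t - γ t) /
        (β * γ t * eps t + β + γ t) with hθ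
  have hD : ∀ t, 0 ≤ t → 0 < β - β * γ t * eps t - γ t := fun t ht => by
    have := hgb t ht
    nlinarith
  have hS : ∀ t, 0 ≤ t → 0 < β * γ t * eps t + β + γ t := fun t ht => by
    have h1 := hγ_pos t ht
    have h2 := heps_pos t ht
    positivity
  have hθm : Measurable θ := by
    rw [hθ]; fun_prop
  have hθ0 : ∀ t, 0 ≤ t → 0 < θ t := fun t ht =>
    div_pos (mul_pos (hprod t ht) (hD t ht)) (hS t ht)
  have hθ1 : ∀ t, 0 ≤ t → θ t ≤ 1 := fun t ht => by
    simp only [hθ]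
    rw [div_le_one (hS t ht)]
    have h1 := hprod t ht
    have h2 := hge t ht
    have h3 := hD t ht
    have h4 := hγ_pos t ht
    have h5 : γ t * eps t * (β - β * γ t * eps t - γ t) ≤ 1 * (β - β * γ t * eps t - γ t) := by
      gcongr
    have h6 := mul_pos hβ h1
    nlinarith
  have hθint : ∀ a b, 0 ≤ a → 0 ≤ b → IntervalIntegrable θ volume a b := by
    intro a b ha hb
    refine (intervalIntegrable_const (c := (1:ℝ))).mono_fun hθm.aestronglyMeasurable ?_
    rw [Filter.EventuallyLE, ae_restrict_iff' measurableSet_uIoc]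
    refine Eventually.of_forall fun t ht => ?_
    have ht0 : 0 ≤ t := (le_min ha hb).trans (le_of_lt ht.1)
    rw [Real.norm_of_nonneg (hθ0 t ht0).le, norm_one]
    exact hθ1 t ht0
  set h : ℝ → ℝ := fun t => ‖x t - Y t‖ ^ 2 with hh
  have hac : ∀ b, 0 ≤ b → AbsolutelyContinuousOnInterval h 0 b := fun b hb =>
    aux_h_ac x Y F x₀ eps epsd P b hb hxc hF hx heps_pos hepsd_int hepsAC heps_mono hP0 hYP hYlip
  have hcont : ContinuousOn h (Ici 0) := by
    intro t ht
    have ht0 : (0:ℝ) ≤ t := ht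
    have h1 := (hac (t + 1) (by linarith)).continuousOn
    rw [uIcc_of_le (by linarith)] at h1
    refine (h1 t ⟨ht0, by linarith⟩).mono_of_mem_nhdsWithin ?_
    have : Iio (t + 1) ∈ 𝓝 t := Iio_mem_nhds (by linarith)
    filter_upwards [mem_nhdsWithin_of_mem_nhds this, self_mem_nhdsWithin] with s hs hs0
    exact ⟨hs0, le_of_lt hs⟩
  -- the main decay claim
  have main : ∀ ρ > 0, ∃ T', 0 ≤ T' ∧ ∀ t, T' ≤ t → h t ≤ 2 * ρ ^ 2 := by
    intro ρ hρ
    set η := ρ / (2 * β * (P + 1)) with hη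
    have hη0 : 0 < η := by positivity
    have hηP : 2 * β * η * P ≤ ρ := by
      have : 2 * β * η * (P + 1) = ρ := by rw [hη]; field_simp
      have : 0 < 2 * β * η := by positivity
      nlinarith
    obtain ⟨T, hT⟩ := eventually_atTop.1 ((Metric.tendsto_nhds.1 hii) η hη0)
    refine aux_gronwall θ h hθm (fun t ht => (hθ0 t ht).le) hθint hiii (max T 0) (ρ ^ 2)
      (le_max_right _ _) (by positivity) hcont (fun t _ => by positivity) ?_
    intro s t hs hst hlow
    have hs0 : 0 ≤ s := (le_max_right _ _).trans hs
    have ht0 : 0 ≤ t := hs0.trans hst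
    have hacst : AbsolutelyContinuousOnInterval h s t := (hac t ht0).mono (by
      rw [uIcc_of_le hst, uIcc_of_le ht0]; exact Icc_subset_Icc_left hs0)
    have h1 := aux_decrease h (fun r => -(ρ ^ 2) * θ r) s t hst hacst
      ((hθint s t hs0 ht0).const_mul _) ?_
    · rw [intervalIntegral.integral_const_mul] at h1
      linarith
    filter_upwards [hacst.ae_differentiableAt, aux_ae_deriv x F x₀ hF hx t,
      aux_ae_deriv eps epsd (eps 0) hepsd_int hepsAC t] with r hr1 hr2 hr3 hr
    have hr0 : 0 ≤ r := hs0.trans hr.1.le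
    have hr' : r ∈ Ioo 0 t := ⟨hs0.trans_lt hr.1, hr.2⟩
    have d1 := (hr1 (by rw [uIcc_of_le hst]; exact ⟨hr.1.le, hr.2.le⟩)).hasDerivAt
    have d2 := aux_deriv x Y eps h P r (F r) (epsd r) (deriv h r) (hr2 hr') (hr3 hr') d1
      (heps_pos r hr0) (fun _ _ => rfl) (fun w hw => hYlip r w hr0 hw)
    have d3 := aux_dissip A B β hβ hA.1 hBmono hBlip (γ r) (eps r) (hγ_pos r hr0)
      (heps_pos r hr0) (hgb r hr0) (x r) (z r) (Y r) (hzA r hr0) (hY r hr0)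
    have d4 : ⟪F r, x r - Y r⟫ ≤ -θ r * ‖x r - Y r‖ ^ 2 := d3
    have d5 : -epsd r / eps r ≤ 2 * β * η * θ r := by
      have k1 := hT r (((le_max_left T 0).trans hs).trans hr.1.le)
      have e1 : β * (1 - γ r * eps r) - γ r = β - β * γ r * eps r - γ r := by ring
      rw [dist_zero_right, Real.norm_eq_abs, e1] at k1
      have hDr := hD r hr0
      have he := heps_pos r hr0
      have hg := hγ_pos r hr0
      have k0 : 0 < eps r ^ 2 * γ r * (β - β * γ r * eps r - γ r) := by positivity
      rw [abs_div, abs_of_pos k0, div_lt_iff₀ k0] at k1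
      have k2 : -epsd r / eps r ≤ η * (γ r * eps r * (β - β * γ r * eps r - γ r)) := by
        rw [div_le_iff₀ he]
        have := neg_le_abs (epsd r)
        nlinarith
      refine k2.trans ?_
      have hSr := hS r hr0
      have k3 : γ r * eps r * (β - β * γ r * eps r - γ r) =
          θ r * (β * γ r * eps r + β + γ r) := by
        simp only [hθ]; field_simp
      have k4 : β * γ r * eps r + β + γ r ≤ 2 * β := by linarith
      rw [k3]
      have := mul_le_mul_of_nonneg_left k4 (mul_nonneg hη0.le (hθ0 r hr0).le)
      linarith
    have hlr := hlow r ⟨hr.1.le, hr.2.le⟩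
    have hθr := hθ0 r hr0
    simp only [hh] at hlr
    set u := ‖x r - Y r‖ with hu
    have hu0 : 0 ≤ u := norm_nonneg _
    have d6 : -epsd r / eps r * P ≤ ρ * θ r := by
      calc _ ≤ 2 * β * η * θ r * P := by gcongr
        _ = (2 * β * η * P) * θ r := by ring
        _ ≤ ρ * θ r := by gcongr
    have d7 : 2 * u * (-epsd r / eps r * P) ≤ 2 * u * (ρ * θ r) := by gcongr
    have d8 : deriv h r ≤ θ r * (-2 * u ^ 2 + 2 * u * ρ) := by linarith
    refine d8.trans ?_
    rw [mul_comm (-(ρ ^ 2))]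
    refine mul_le_mul_of_nonneg_left ?_ hθr.le
    nlinarith [sq_nonneg (u - ρ)]
  have hxY : Tendsto (fun t => x t - Y t) atTop (𝓝 0) := by
    rw [Metric.tendsto_atTop]
    intro ε hε
    obtain ⟨T', hT'0, hT'⟩ := main (ε / 2) (by positivity)
    refine ⟨T', fun t ht => ?_⟩
    have h1 := hT' t ht
    simp only [hh] at h1
    rw [dist_zero_right]
    refine lt_of_pow_lt_pow_left₀ 2 hε.le ?_
    nlinarith [pow_pos hε 2]
  have hzY : Tendsto (fun t => z t - Y t) atTop (𝓝 0) := by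
    rw [tendsto_zero_iff_norm_tendsto_zero] at hxY ⊢
    have h3 : Tendsto (fun t => 3 * ‖x t - Y t‖) atTop (𝓝 0) := by
      simpa using hxY.const_mul 3
    refine squeeze_zero' (Eventually.of_forall fun t => norm_nonneg _) ?_ h3
    filter_upwards [eventually_ge_atTop 0] with t ht
    exact aux_z_bound A B β hβ hA.1 hBlip (γ t) (eps t) (hγ_pos t ht) (heps_pos t ht)
      (hgβ' t ht) (hge t ht) (x t) (z t) (Y t) (hzA t ht) (hY t ht)
  refine ⟨p, hpz, hpmin, ?_, ?_⟩
  · simpa using hxY.add hYp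
  · simpa using hzY.add hYp
end
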